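/- Let f : ℝ₊ × X → X be a continuous semiflow on a compact metric space X and x ∈ X such that C_x is not generic and the Birkhoff recurrent points of f are dense in C_x. Then f is sensitive near C_x: there exists ε > 0 such that for every a ∈ X, every x̂ ∈ C_x and every neighborhood U of x̂, there exists c ∈ U with limsup_{t→∞} d(f(t,a), f(t,c)) ≥ ε. -/

import Mathlib

open MeasureTheory Filter Metric Set Topology
open scoped Classical

noncomputable section

/-- The set `S ⊆ ℝ` has density `α` in `[0,∞)`. -/
def HasDens (S : Set ℝ) (α : ℝ) : Prop :=
  Filter.Tendsto (fun T : ℝ => (MeasureTheory.volume (S ∩ Set.Icc 0 T)).toReal / T)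
    Filter.atTop (nhds α)

/-- `f` is a continuous semiflow on `X` (time in `[0,∞)`). -/
def IsSemiflow {X : Type*} [MetricSpace X] (f : ℝ → X → X) : Prop :=
  ContinuousOn (fun p : ℝ × X => f p.1 p.2) (Set.Ici 0 ×ˢ Set.univ) ∧
  (∀ x : X, f 0 x = x) ∧
  (∀ s t : ℝ, 0 ≤ s → 0 ≤ t → ∀ x : X, f s (f t x) = f (s + t) x)

/-- `C` is a center of attraction of the motion `f (t, x)`. -/
def IsCtr {X : Type*} [MetricSpace X] (f : ℝ → X → X) (x : X) (C : Set X) : Prop :=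
  IsClosed C ∧ ∀ ε > (0 : ℝ), HasDens {t : ℝ | 0 ≤ t ∧ f t x ∈ Metric.thickening ε C} 1

/-- `C` is the minimal center of attraction of the motion `f (t, x)`. -/
def IsMCA {X : Type*} [MetricSpace X] (f : ℝ → X → X) (x : X) (C : Set X) : Prop :=
  IsCtr f x C ∧ ∀ C' ⊆ C, IsCtr f x C' → C' = C

/-- `Λ` is invariant under the semiflow `f`. -/
def FlowInvariant {X : Type*} [MetricSpace X] (f : ℝ → X → X) (Λ : Set X) : Prop :=
  ∀ t : ℝ, 0 ≤ t → ∀ z ∈ Λ, f t z ∈ Λ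

/-- `Λ` is a minimal set of the semiflow `f`. -/
def IsMinimalSet {X : Type*} [MetricSpace X] (f : ℝ → X → X) (Λ : Set X) : Prop :=
  Λ.Nonempty ∧ IsClosed Λ ∧ FlowInvariant f Λ ∧
    ∀ Λ' ⊆ Λ, Λ'.Nonempty → IsClosed Λ' → FlowInvariant f Λ' → Λ' = Λ

/-- `p` is a Birkhoff recurrent point of `f`: its orbit closure is minimal. -/
def BirkhoffRecurrent {X : Type*} [MetricSpace X] (f : ℝ → X → X) (p : X) : Prop :=
  IsMinimalSet f (closure {y : X | ∃ t : ℝ, 0 ≤ t ∧ f t p = y})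

section Density

lemma volume_inter_Icc_ne_top (S : Set ℝ) (T : ℝ) : volume (S ∩ Icc 0 T) ≠ ⊤ :=
  ((measure_mono inter_subset_right).trans_lt measure_Icc_lt_top).ne

lemma toReal_volume_inter_Icc_le (S : Set ℝ) {T : ℝ} (hT : 0 ≤ T) :
    (volume (S ∩ Icc 0 T)).toReal ≤ T := by
  have h : (volume (S ∩ Icc 0 T)).toReal ≤ (volume (Icc 0 T)).toReal :=
    ENNReal.toReal_mono measure_Icc_lt_top.ne (measure_mono inter_subset_right)
  simpa [Real.volume_Icc, hT] using h

lemma toReal_volume_inter_Icc_le_add {S A B : Set ℝ} (h : S ⊆ A ∪ B) (T : ℝ) :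
    (volume (S ∩ Icc 0 T)).toReal ≤
      (volume (A ∩ Icc 0 T)).toReal + (volume (B ∩ Icc 0 T)).toReal := by
  rw [← ENNReal.toReal_add (volume_inter_Icc_ne_top A T) (volume_inter_Icc_ne_top B T)]
  refine ENNReal.toReal_mono
    (ENNReal.add_ne_top.2 ⟨volume_inter_Icc_ne_top A T, volume_inter_Icc_ne_top B T⟩) ?_
  refine le_trans (measure_mono ?_) (measure_union_le _ _)
  rw [← union_inter_distrib_right]
  exact inter_subset_inter_left _ h

lemma hasDens_zero_of_le {S : Set ℝ} {g : ℝ → ℝ} (hg : Tendsto g atTop (𝓝 0))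
    (h : ∀ T > 0, (volume (S ∩ Icc 0 T)).toReal / T ≤ g T) : HasDens S 0 := by
  refine tendsto_of_tendsto_of_tendsto_of_le_of_le' tendsto_const_nhds hg ?_ ?_
  · filter_upwards [eventually_gt_atTop 0] with T hT
    positivity
  · filter_upwards [eventually_gt_atTop 0] with T hT using h T hT

lemma HasDens.compl_zero {A : Set ℝ} (hA : MeasurableSet A) (h : HasDens A 1) :
    HasDens Aᶜ 0 := by
  have h1 : Tendsto (fun T : ℝ => 1 - (volume (A ∩ Icc 0 T)).toReal / T) atTop (𝓝 0) := by
    simpa using h.const_sub 1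
  refine hasDens_zero_of_le h1 fun T hT => ?_
  have h2 : volume (A ∩ Icc 0 T) + volume (Aᶜ ∩ Icc 0 T) = volume (Icc 0 T) := by
    rw [inter_comm A, inter_comm Aᶜ, ← sdiff_eq]
    exact measure_inter_add_sdiff _ hA
  have h3 := congrArg ENNReal.toReal h2
  rw [ENNReal.toReal_add (volume_inter_Icc_ne_top _ _) (volume_inter_Icc_ne_top _ _),
    Real.volume_Icc, sub_zero, ENNReal.toReal_ofReal hT.le] at h3
  rw [one_sub_div hT.ne']
  gcongr
  linarith

lemma HasDens.shift_zero {D : Set ℝ} (h : HasDens D 0) {s : ℝ} (hs : 0 ≤ s) :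
    HasDens {t | t + s ∈ D} 0 := by
  have hr : Tendsto (fun T : ℝ => (T + s) / T) atTop (𝓝 1) := by
    have h1 : Tendsto (fun T : ℝ => 1 + s / T) atTop (𝓝 1) := by
      simpa using (tendsto_const_nhds (x := s)).div_atTop tendsto_id |>.const_add 1
    refine h1.congr' ?_
    filter_upwards [eventually_gt_atTop 0] with T hT
    field_simp
  have h2 := (h.comp (tendsto_atTop_add_const_right _ s tendsto_id)).mul hr
  rw [zero_mul] at h2
  refine hasDens_zero_of_le h2 fun T hT => ?_
  have hTs : 0 < T + s := by linarith
  simp only [Function.comp, id]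
  rw [div_mul_div_cancel₀ hTs.ne']
  refine div_le_div_of_nonneg_right
    (ENNReal.toReal_mono (volume_inter_Icc_ne_top _ _) ?_) hT.le
  rw [← measure_preimage_add_right volume s (D ∩ Icc 0 (T + s))]
  refine measure_mono fun t ht => ⟨ht.1, ?_, ?_⟩
  · linarith [ht.2.1]
  · linarith [ht.2.2]

lemma HasDens.biUnion_zero {ι : Type*} (F : Finset ι) {D : ι → Set ℝ}
    (h : ∀ i ∈ F, HasDens (D i) 0) : HasDens (⋃ i ∈ F, D i) 0 := by
  induction F using Finset.induction_on with
  | empty => simp [HasDens]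
  | insert i F _ ih =>
    have h1 := (h i (Finset.mem_insert_self i F)).add
      (ih fun j hj => h j (Finset.mem_insert_of_mem hj))
    rw [add_zero] at h1
    refine hasDens_zero_of_le h1 fun T hT => ?_
    rw [← add_div]
    gcongr
    exact toReal_volume_inter_Icc_le_add (by rw [Finset.set_biUnion_insert]) T

lemma HasDens.exists_notMem {D : Set ℝ} (h : HasDens D 0) : ∃ t, 0 ≤ t ∧ t ∉ D := by
  by_contra! hD
  have h1 : Tendsto (fun _ : ℝ => (1 : ℝ)) atTop (𝓝 0) := by
    refine h.congr' ?_
    filter_upwards [eventually_gt_atTop 0] with T hT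
    rw [inter_eq_right.2 fun t ht => hD t ht.1, Real.volume_Icc, sub_zero,
      ENNReal.toReal_ofReal hT.le, div_self hT.ne']
  exact one_ne_zero (tendsto_nhds_unique tendsto_const_nhds h1)

lemma HasDens.one_of_subset_union_Icc {S S' : Set ℝ} {T₀ : ℝ} (h : HasDens S 1)
    (hsub : S ⊆ S' ∪ Icc 0 T₀) : HasDens S' 1 := by
  have h0 : Tendsto (fun T : ℝ => |T₀| / T) atTop (𝓝 0) :=
    tendsto_const_nhds.div_atTop tendsto_id
  have h1 := h.sub h0
  rw [sub_zero] at h1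
  refine tendsto_of_tendsto_of_tendsto_of_le_of_le' h1 tendsto_const_nhds ?_ ?_
  · filter_upwards [eventually_gt_atTop 0] with T hT
    rw [← sub_div]
    gcongr
    have h2 := toReal_volume_inter_Icc_le_add hsub T
    have h3 : (volume (Icc 0 T₀ ∩ Icc 0 T)).toReal ≤ |T₀| := by
      rw [inter_comm]
      refine (ENNReal.toReal_mono (volume_inter_Icc_ne_top _ |T₀|)
        (measure_mono fun t ht => ?_)).trans (toReal_volume_inter_Icc_le (Icc 0 T) (abs_nonneg T₀))
      exact ⟨ht.1, ht.2.1, ht.2.2.trans (le_abs_self T₀)⟩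
    linarith
  · filter_upwards [eventually_gt_atTop 0] with T hT
    exact div_le_one_of_le₀ (toReal_volume_inter_Icc_le S' hT.le) hT.le

lemma hasDens_Ici_zero : HasDens (Ici 0) 1 := by
  refine (tendsto_const_nhds (x := (1 : ℝ))).congr' ?_
  filter_upwards [eventually_gt_atTop 0] with T hT
  rw [inter_eq_right.2 fun t ht => ht.1, Real.volume_Icc, sub_zero,
    ENNReal.toReal_ofReal hT.le, div_self hT.ne']

end Density

section Semiflow

variable {X : Type*} [MetricSpace X] {f : ℝ → X → X}

lemma IsSemiflow.continuous (hf : IsSemiflow f) {t : ℝ} (ht : 0 ≤ t) : Continuous (f t) :=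
  hf.1.comp_continuous (f := fun x : X => (t, x)) (by fun_prop) fun _ => ⟨ht, mem_univ _⟩

lemma IsSemiflow.continuousOn_orbit (hf : IsSemiflow f) (x : X) :
    ContinuousOn (fun t => f t x) (Ici 0) :=
  hf.1.comp (f := fun t : ℝ => (t, x)) (by fun_prop) fun _ ht => ⟨ht, mem_univ _⟩

lemma IsSemiflow.measurableSet_visits (hf : IsSemiflow f) (x : X) {V : Set X} (hV : IsOpen V) :
    MeasurableSet {t : ℝ | 0 ≤ t ∧ f t x ∈ V} := by
  obtain ⟨u, hu, h⟩ := continuousOn_iff'.1 (hf.continuousOn_orbit x) V hV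
  have h1 : {t : ℝ | 0 ≤ t ∧ f t x ∈ V} = u ∩ Ici 0 := by
    rw [← h, inter_comm]
    rfl
  rw [h1]
  exact hu.measurableSet.inter measurableSet_Ici

lemma IsSemiflow.flowInvariant_closure_orbit (hf : IsSemiflow f) (x : X) :
    FlowInvariant f (closure {y : X | ∃ t : ℝ, 0 ≤ t ∧ f t x = y}) := by
  intro t ht
  refine MapsTo.closure (f := f t) ?_ (hf.continuous ht)
  rintro _ ⟨s, hs, rfl⟩
  exact ⟨t + s, add_nonneg ht hs, (hf.2.2 t s ht hs x).symm⟩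

lemma isCtr_of_orbit_subset {y : X} {C : Set X} (hC : IsClosed C)
    (h : ∀ s, 0 ≤ s → f s y ∈ C) : IsCtr f y C := by
  refine ⟨hC, fun ε hε => ?_⟩
  have h1 : {t : ℝ | 0 ≤ t ∧ f t y ∈ thickening ε C} = Ici 0 :=
    Set.ext fun t => ⟨fun ht => ht.1, fun ht => ⟨ht, self_subset_thickening hε C (h t ht)⟩⟩
  rw [h1]
  exact hasDens_Ici_zero

lemma IsCtr.exists_orbit_subset [CompactSpace X] (hf : IsSemiflow f) {y : X} {C : Set X}
    (hC : IsCtr f y C) : ∃ z, ∀ s, 0 ≤ s → f s z ∈ C := by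
  let K : Ici (0 : ℝ) × Ioi (0 : ℝ) → Set X := fun i => f i.1 ⁻¹' cthickening i.2 C
  have hK : ∀ i, IsClosed (K i) := fun i => isClosed_cthickening.preimage (hf.continuous i.1.2)
  obtain ⟨z, hz⟩ : (⋂ i, K i).Nonempty := by
    refine CompactSpace.iInter_nonempty hK fun F => ?_
    obtain ⟨t, ht, htF⟩ := (HasDens.biUnion_zero F fun i _ =>
      ((hC.2 i.2 i.2.2).compl_zero
        (hf.measurableSet_visits y isOpen_thickening)).shift_zero i.1.2).exists_notMem
    refine ⟨f t y, mem_iInter₂.2 fun i hi => ?_⟩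
    have h1 : 0 ≤ t + i.1 ∧ f (t + i.1) y ∈ thickening i.2 C := by
      by_contra h
      exact htF (mem_iUnion₂.2 ⟨i, hi, h⟩)
    have h2 : f i.1 (f t y) = f (t + i.1) y := by rw [hf.2.2 _ _ i.1.2 ht, add_comm]
    change f i.1 (f t y) ∈ cthickening i.2 C
    rw [h2]
    exact thickening_subset_cthickening _ _ h1.2
  refine ⟨z, fun s hs => ?_⟩
  rw [← hC.1.closure_eq, closure_eq_iInter_cthickening]
  exact mem_iInter₂.2 fun δ hδ => mem_iInter.1 hz (⟨s, hs⟩, ⟨δ, hδ⟩)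

lemma IsMCA.exists_dist_lt {x q : X} {C : Set X} (hC : IsMCA f x C) (hq : q ∈ C) {r : ℝ}
    (hr : 0 < r) (T : ℝ) : ∃ t, T ≤ t ∧ dist (f t x) q < r := by
  by_contra! h
  have hctr : IsCtr f x (C \ ball q (r / 2)) := by
    refine ⟨hC.1.1.sdiff isOpen_ball, fun ε hε => ?_⟩
    refine (hC.1.2 (min ε (r / 2)) (by positivity)).one_of_subset_union_Icc (T₀ := T) ?_
    rintro t ⟨ht, htC⟩
    rcases le_total t T with htT | htT
    · exact Or.inr ⟨ht, htT⟩
    · obtain ⟨c, hc, hd⟩ := mem_thickening_iff.1 htC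
      refine Or.inl ⟨ht, mem_thickening_iff.2
        ⟨c, ⟨hc, fun hcq => ?_⟩, hd.trans_le (min_le_left _ _)⟩⟩
      have h1 := hd.trans_le (min_le_right _ _)
      have h2 := dist_triangle (f t x) c q
      have h3 := mem_ball.1 hcq
      linarith [h t htT]
  have h1 := hC.2 _ sdiff_subset hctr
  rw [← h1] at hq
  exact hq.2 (mem_ball_self (half_pos hr))

lemma IsMCA.exists_notMem_closure_orbit [CompactSpace X] (hf : IsSemiflow f) {x : X} {C : Set X}
    (hC : IsMCA f x C) (hng : ¬ ∃ y ∈ C, IsMCA f y C) :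
    ∃ m ∈ C, ∃ q ∈ C, q ∉ closure {y : X | ∃ t : ℝ, 0 ≤ t ∧ f t m = y} := by
  by_contra! h
  obtain ⟨y, hy⟩ := hC.1.exists_orbit_subset hf
  refine hng ⟨y, hf.2.1 y ▸ hy 0 le_rfl, isCtr_of_orbit_subset hC.1.1 hy, fun C' hC' hctr => ?_⟩
  obtain ⟨z, hz⟩ := hctr.exists_orbit_subset hf
  refine hC'.antisymm fun q hq => ?_
  refine closure_minimal ?_ hctr.1 (h z (hC' (hf.2.1 z ▸ hz 0 le_rfl)) q hq)
  rintro _ ⟨t, ht, rfl⟩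
  exact hz t ht

lemma BirkhoffRecurrent.orbit_subset {p p' : X} {K : Set X} (hf : IsSemiflow f)
    (hp : BirkhoffRecurrent f p) (hp' : p' ∈ closure {y : X | ∃ t : ℝ, 0 ≤ t ∧ f t p = y})
    (hK : IsClosed K) (h : ∀ s, 0 ≤ s → f s p' ∈ K) {t : ℝ} (ht : 0 ≤ t) : f t p ∈ K := by
  have h1 : closure {y : X | ∃ t : ℝ, 0 ≤ t ∧ f t p' = y} =
      closure {y : X | ∃ t : ℝ, 0 ≤ t ∧ f t p = y} := by
    refine hp.2.2.2 _ (closure_minimal ?_ isClosed_closure)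
      ⟨f 0 p', subset_closure ⟨0, le_rfl, rfl⟩⟩ isClosed_closure
      (hf.flowInvariant_closure_orbit p')
    rintro _ ⟨s, hs, rfl⟩
    exact hp.2.2.1 s hs p' hp'
  have h2 : f t p ∈ closure {y : X | ∃ t : ℝ, 0 ≤ t ∧ f t p' = y} :=
    h1 ▸ subset_closure ⟨t, ht, rfl⟩
  refine closure_minimal ?_ hK h2
  rintro _ ⟨s, hs, rfl⟩
  exact h s hs

/-- If the motion of `x` eventually shadows that of a Birkhoff recurrent point `p` within `δ`,
and `m` is an `ω`-limit point of `x`, then the orbit of `p` stays `δ`-close to the orbit of `m`. -/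
lemma BirkhoffRecurrent.mem_cthickening_of_shadow [CompactSpace X] (hf : IsSemiflow f)
    {p x m : X} {δ T : ℝ} (hp : BirkhoffRecurrent f p)
    (hshadow : ∀ t, T ≤ t → dist (f t x) (f t p) ≤ δ)
    (hm : ∀ r > 0, ∀ T : ℝ, ∃ t, T ≤ t ∧ dist (f t x) m < r) {t : ℝ} (ht : 0 ≤ t) :
    f t p ∈ cthickening δ (closure {y : X | ∃ t : ℝ, 0 ≤ t ∧ f t m = y}) := by
  choose τ hτT hτ using fun n : ℕ => hm (1 / ((n : ℝ) + 1)) (by positivity) (max T 0)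
  have hx : Tendsto (fun n => f (τ n) x) atTop (𝓝 m) :=
    tendsto_iff_dist_tendsto_zero.2 (squeeze_zero (fun _ => dist_nonneg) (fun n => (hτ n).le)
      tendsto_one_div_add_atTop_nhds_zero_nat)
  have hτ0 : ∀ n, 0 ≤ τ n := fun n => (le_max_right _ _).trans (hτT n)
  obtain ⟨p', φ, hφ, hp'⟩ := CompactSpace.tendsto_subseq fun n => f (τ n) p
  refine hp.orbit_subset hf (mem_closure_of_tendsto hp' (Eventually.of_forall fun n =>
    ⟨τ (φ n), hτ0 _, rfl⟩)) isClosed_cthickening (fun s hs => ?_) ht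
  refine mem_cthickening_of_dist_le _ (f s m) _ _ (subset_closure ⟨s, hs, rfl⟩) ?_
  have h1 := ((hf.continuous hs).tendsto p').comp hp'
  have h2 := ((hf.continuous hs).tendsto m).comp (hx.comp hφ.tendsto_atTop)
  refine le_of_tendsto (h1.dist h2) (Eventually.of_forall fun n => ?_)
  simp only [Function.comp]
  rw [dist_comm, hf.2.2 s _ hs (hτ0 _), hf.2.2 s _ hs (hτ0 _)]
  exact hshadow _ (by linarith [(le_max_left T 0).trans (hτT (φ n))])

lemma eventually_dist_lt_of_limsup_lt [CompactSpace X] {u v : ℝ → X} {ε : ℝ}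
    (h : limsup (fun t => dist (u t) (v t)) atTop < ε) : ∀ᶠ t in atTop, dist (u t) (v t) < ε :=
  eventually_lt_of_limsup_lt h ⟨diam (univ : Set X), eventually_map.2 (Eventually.of_forall
    fun _ => dist_le_diam_of_mem isCompact_univ.isBounded (mem_univ _) (mem_univ _))⟩

end Semiflow

theorem sensitive_near_mca {X : Type*} [MetricSpace X] [CompactSpace X]
    (f : ℝ → X → X) (hf : IsSemiflow f) (x : X) (C : Set X) (hC : IsMCA f x C)
    (hng : ¬ ∃ y ∈ C, IsMCA f y C)
    (hdense : C ⊆ closure {p : X | BirkhoffRecurrent f p}) :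
    ∃ ε > (0 : ℝ), ∀ a : X, ∀ xhat ∈ C, ∀ U ∈ nhds xhat,
      ∃ c ∈ U, ε ≤ Filter.limsup (fun t : ℝ => dist (f t a) (f t c)) Filter.atTop := by
  obtain ⟨m, hm, q, hq, hqm⟩ := hC.exists_notMem_closure_orbit hf hng
  set M := closure {y : X | ∃ t : ℝ, 0 ≤ t ∧ f t m = y}
  have hMne : M.Nonempty := ⟨f 0 m, subset_closure ⟨0, le_rfl, rfl⟩⟩
  have hd : 0 < infDist q M := (isClosed_closure.notMem_iff_infDist_pos hMne).1 hqm
  refine ⟨infDist q M / 6, by positivity, fun a xhat hxhat U hU => ?_⟩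
  set ε := infDist q M / 6 with hε
  by_contra! hlt
  obtain ⟨p, hpU, hp⟩ := mem_closure_iff_nhds.1 (hdense hxhat) U hU
  obtain ⟨r, hr, hrU⟩ := Metric.mem_nhds_iff.1 hU
  obtain ⟨t₀, ht₀, hxU⟩ := hC.exists_dist_lt hxhat hr 0
  have hω : ∀ y ∈ C, ∀ r > 0, ∀ T : ℝ, ∃ t, T ≤ t ∧ dist (f t (f t₀ x)) y < r := by
    intro y hy r hr T
    obtain ⟨t, ht, hty⟩ := hC.exists_dist_lt hy hr (max T 0 + t₀)
    have h0 : 0 ≤ t - t₀ := by linarith [le_max_right T 0]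
    refine ⟨t - t₀, by linarith [le_max_left T 0], ?_⟩
    rwa [hf.2.2 _ _ h0 ht₀, sub_add_cancel]
  obtain ⟨T, hT⟩ := eventually_atTop.1
    ((eventually_dist_lt_of_limsup_lt (hlt _ (hrU hxU))).and
      (eventually_dist_lt_of_limsup_lt (hlt p hpU)))
  have hshadow : ∀ t, T ≤ t → dist (f t (f t₀ x)) (f t p) ≤ 2 * ε := fun t ht => by
    have h1 := dist_triangle_left (f t (f t₀ x)) (f t p) (f t a)
    linarith [(hT t ht).1, (hT t ht).2]
  obtain ⟨t, ht, htq⟩ := hω q hq ε (by positivity) (max T 0)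
  have h1 := hp.mem_cthickening_of_shadow hf hshadow (hω m hm) ((le_max_right _ _).trans ht)
  have h2 : infDist (f t p) M ≤ 2 * ε :=
    ENNReal.toReal_le_of_le_ofReal (by positivity) (mem_cthickening_iff.1 h1)
  have h3 := infDist_le_infDist_add_dist (s := M) (x := q) (y := f t p)
  have h4 := dist_triangle_left q (f t p) (f t (f t₀ x))
  linarith [hshadow t ((le_max_left _ _).trans ht)]
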